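/- arXiv:1202.6188 — 2 statements merged into one kernel-verified Lean document; each statement's English description precedes it below -/
import Mathlib

section
/- Let Q̂ be a probability measure on F_T satisfying the numéraire relation. Then: (a) Q̂(S = T+1) = 1; (b) the process 1/X (with 1/∞ := 0 and 1/0 := ∞) is a Q̂-local martingale, and in fact the stopped process (1/X)^{S_i} is a Q̂-martingale for every i ∈ ℕ; (c) for every i ∈ ℕ, Q is absolutely continuous with respect to Q̂ on F_{S_i} with density x_0 / X_{S_i ∧ T}, i.e., Q(A) = x_0 · E^{Q̂}[1_A / X_{S_i ∧ T}] for every A ∈ F_{S_i}. -/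
open MeasureTheory Filter Set Topology
open scoped ENNReal NNReal

noncomputable section

namespace Paper

/-- `τ` is a stopping time with respect to the raw filtration `F`,
taking values in `[0,T] ∪ {T+1}`. -/
def IsStopT {Ω : Type*} (F : ℝ → MeasurableSpace Ω) (T : ℝ) (τ : Ω → ℝ) : Prop :=
  (∀ t : ℝ, MeasurableSet[F t] {ω | τ ω ≤ t}) ∧ ∀ ω, τ ω ∈ Icc (0:ℝ) T ∪ {T + 1}

/-- `A ∈ F_τ`, the σ-algebra associated with the stopping time `τ`. -/
def MemFtau {Ω : Type*} (F : ℝ → MeasurableSpace Ω) (τ : Ω → ℝ) (A : Set Ω) : Prop :=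
  ∀ t : ℝ, MeasurableSet[F t] (A ∩ {ω | τ ω ≤ t})

/-- the σ-algebra `F_τ` of a stopping time `τ` (for a stopping time the generating
family below is already a σ-algebra, so this is exactly the usual `F_τ`). -/
def sigmaAt {Ω : Type*} (F : ℝ → MeasurableSpace Ω) (τ : Ω → ℝ) : MeasurableSpace Ω :=
  MeasurableSpace.generateFrom {A | MemFtau F τ A}

/-- the stopped process `N^τ`, i.e. `N^τ_t := N_{t ∧ τ ∧ T}`. -/
def stopped {Ω : Type*} (T : ℝ) (N : ℝ → Ω → ℝ≥0∞) (τ : Ω → ℝ) : ℝ → Ω → ℝ≥0∞ :=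
  fun t ω => N (min t (min (τ ω) T)) ω

/-- the value of a process at a stopping time, `N_τ := N_{τ ∧ T}`. -/
def valueAt {Ω : Type*} (T : ℝ) (N : ℝ → Ω → ℝ≥0∞) (τ : Ω → ℝ) : Ω → ℝ≥0∞ :=
  fun ω => N (min (τ ω) T) ω

/-- `N` is a `P`-martingale on the time horizon `[0,T]`: it is adapted, `P`-integrable, and
satisfies `E^P[N_t ∣ F_s] = N_s` for all `0 ≤ s ≤ t ≤ T`.  For nonnegative
(`ℝ≥0∞`-valued) integrable adapted processes the conditional-expectation identity is
equivalent to the defining set-integral identity used here. -/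
def IsMart {Ω : Type*} (F : ℝ → MeasurableSpace Ω) (T : ℝ) (P : @Measure Ω (F T))
    (N : ℝ → Ω → ℝ≥0∞) : Prop :=
  (∀ t ∈ Icc (0:ℝ) T, Measurable[F t] (N t)) ∧
  (∀ t ∈ Icc (0:ℝ) T, ∫⁻ ω, N t ω ∂P ≠ ⊤) ∧
  ∀ s t : ℝ, 0 ≤ s → s ≤ t → t ≤ T → ∀ A : Set Ω, MeasurableSet[F s] A →
    ∫⁻ ω in A, N t ω ∂P = ∫⁻ ω in A, N s ω ∂P

/-- `N` is a `P`-local martingale on `[0,T]`. -/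
def IsLocMart {Ω : Type*} (F : ℝ → MeasurableSpace Ω) (T : ℝ) (P : @Measure Ω (F T))
    (N : ℝ → Ω → ℝ≥0∞) : Prop :=
  ∃ τ : ℕ → Ω → ℝ, (∀ n, IsStopT F T (τ n)) ∧ (∀ n ω, τ n ω ≤ τ (n + 1) ω) ∧
    P {ω | ∀ᶠ n in atTop, τ n ω = T + 1} = 1 ∧
    ∀ n, IsMart F T P (stopped T N (τ n))

/-- `N` is a `P`-local martingale on the stochastic interval `[0,τ)`. -/
def IsLocMartBefore {Ω : Type*} (F : ℝ → MeasurableSpace Ω) (T : ℝ) (P : @Measure Ω (F T))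
    (N : ℝ → Ω → ℝ≥0∞) (τ : Ω → ℝ) : Prop :=
  ∀ σ : Ω → ℝ, IsStopT F T σ → (∀ᵐ ω ∂P, σ ω < τ ω) → IsLocMart F T P (stopped T N σ)

/-- `N` is a `P`-martingale on the stochastic interval `[0,τ)`. -/
def IsMartBefore {Ω : Type*} (F : ℝ → MeasurableSpace Ω) (T : ℝ) (P : @Measure Ω (F T))
    (N : ℝ → Ω → ℝ≥0∞) (τ : Ω → ℝ) : Prop :=
  ∀ σ : Ω → ℝ, IsStopT F T σ → (∀ᵐ ω ∂P, σ ω < τ ω) → IsMart F T P (stopped T N σ)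

/-- the first time in `[0,T]` at which `X` is `≥ c`; equal to `T+1` if this never
happens (`inf ∅ := T+1`). -/
def hitAbove {Ω : Type*} (T : ℝ) (X : ℝ → Ω → ℝ≥0∞) (c : ℝ≥0∞) (ω : Ω) : ℝ :=
  sInf ({t ∈ Icc (0:ℝ) T | c ≤ X t ω} ∪ {T + 1})

/-- the first time in `[0,T]` at which `X` is `≤ c`; equal to `T+1` if this never
happens (`inf ∅ := T+1`). -/
def hitBelow {Ω : Type*} (T : ℝ) (X : ℝ → Ω → ℝ≥0∞) (c : ℝ≥0∞) (ω : Ω) : ℝ :=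
  sInf ({t ∈ Icc (0:ℝ) T | X t ω ≤ c} ∪ {T + 1})

/-- `R = lim_i R_i` where `R_i = inf {t ∈ [0,T] : X_t ≥ i}` (explosion time of `X`);
the nondecreasing limit is the supremum. -/
def Rt {Ω : Type*} (T : ℝ) (X : ℝ → Ω → ℝ≥0∞) (ω : Ω) : ℝ :=
  ⨆ i : ℕ, hitAbove T X (i : ℝ≥0∞) ω

/-- `S = lim_i S_i` where `S_i = inf {t ∈ [0,T] : X_t ≤ 1/i}` (hitting time of `0`);
the nondecreasing limit is the supremum. -/
def St {Ω : Type*} (T : ℝ) (X : ℝ → Ω → ℝ≥0∞) (ω : Ω) : ℝ :=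
  ⨆ i : ℕ, hitBelow T X ((i : ℝ≥0∞))⁻¹ ω

/-- The standing assumptions: `0 < T`; `(F_t)` is a (monotone) filtration that is
right-continuous on `[0,T)`; `X` is adapted with continuous `[0,∞]`-valued paths absorbed
at `0` and `∞`; `x₀ ∈ (0,∞)`; `Q` is a probability measure on `F_T` with
`Q(R = T+1) = 1`, `Q(X_0 = x₀) = 1` and `X` a `Q`-local martingale. -/
structure Setup {Ω : Type*} (F : ℝ → MeasurableSpace Ω) (T : ℝ) (X : ℝ → Ω → ℝ≥0∞)
    (x₀ : ℝ≥0∞) (Q : @Measure Ω (F T)) : Prop where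
  T_pos : 0 < T
  mono : ∀ s t : ℝ, s ≤ t → F s ≤ F t
  rightCont : ∀ t ∈ Ico (0:ℝ) T, F t = ⨅ s ∈ Ioc t T, F s
  prob : IsProbabilityMeasure Q
  adapted : ∀ t ∈ Icc (0:ℝ) T, Measurable[F t] (X t)
  contPaths : ∀ ω, ContinuousOn (fun t => X t ω) (Icc 0 T)
  absorbing : ∀ ω, ∀ t ∈ Icc (0:ℝ) T, (X t ω = 0 ∨ X t ω = ⊤) →
    ∀ s ∈ Icc t T, X s ω = X t ω
  x₀_pos : 0 < x₀
  x₀_lt_top : x₀ < ⊤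
  noExplosion : Q {ω | Rt T X ω = T + 1} = 1
  init : Q {ω | X 0 ω = x₀} = 1
  locMart : IsLocMart F T Q X

/-- The numéraire relation between `Q` and `Q̂`: for every stopping time `τ` with values
in `[0,T] ∪ {T+1}` and every `A ∈ F_τ`,
`Q̂(A ∩ {X_τ < ∞}) = (1/x₀)·E^Q[1_A · X_τ]` (with `X_τ := X_{τ ∧ T}`). -/
def NumeraireRel {Ω : Type*} (F : ℝ → MeasurableSpace Ω) (T : ℝ) (X : ℝ → Ω → ℝ≥0∞)
    (x₀ : ℝ≥0∞) (Q Qh : @Measure Ω (F T)) : Prop :=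
  ∀ τ : Ω → ℝ, IsStopT F T τ → ∀ A : Set Ω, MemFtau F τ A →
    Qh (A ∩ {ω | valueAt T X τ ω < ⊤}) = (∫⁻ ω in A, valueAt T X τ ω ∂Q) / x₀

/-- If `P = (Z / x₀) • Q` on `{Z < ∞}` and on the sub-σ-algebra `m`, then `Q = (x₀ / Z) • P`
on `m`. -/
lemma measure_eq_mul_setLIntegral_inv {Ω : Type*} {m m0 : MeasurableSpace Ω} (hm : m ≤ m0)
    {P Q : Measure Ω} {Z : Ω → ℝ≥0∞} (hZ : Measurable[m] Z) {x₀ : ℝ≥0∞}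
    (hx0 : x₀ ≠ 0) (hxt : x₀ ≠ ⊤)
    (h : ∀ A, MeasurableSet[m] A → P (A ∩ {ω | Z ω < ⊤}) = (∫⁻ ω in A, Z ω ∂Q) / x₀)
    (hpos : ∀ᵐ ω ∂Q, Z ω ≠ 0 ∧ Z ω ≠ ⊤) {A : Set Ω} (hA : MeasurableSet[m] A) :
    Q A = x₀ * ∫⁻ ω in A, (Z ω)⁻¹ ∂P := by
  have hZ0 : Measurable Z := hZ.mono hm le_rfl
  have hlt : MeasurableSet[m] {ω | Z ω < ⊤} := measurableSet_lt hZ measurable_const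
  have htrim : (P.restrict {ω | Z ω < ⊤}).trim hm = (x₀⁻¹ • Q.withDensity Z).trim hm := by
    refine @Measure.ext _ m _ _ fun B hB => ?_
    rw [trim_measurableSet_eq hm hB, trim_measurableSet_eq hm hB,
      Measure.restrict_apply (hm _ hB), h B hB, Measure.smul_apply,
      withDensity_apply _ (hm _ hB), smul_eq_mul, ENNReal.div_eq_inv_mul]
  have hf : Measurable[m] (A.indicator fun ω => (Z ω)⁻¹) := hZ.inv.indicator hA
  have hf0 : Measurable (A.indicator fun ω => (Z ω)⁻¹) := hf.mono hm le_rfl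
  have hrestrict : ∫⁻ ω in A, (Z ω)⁻¹ ∂P
      = ∫⁻ ω, A.indicator (fun ω => (Z ω)⁻¹) ω ∂(P.restrict {ω | Z ω < ⊤}) := by
    rw [← lintegral_indicator (hm _ hA), ← lintegral_indicator (hm _ hlt)]
    refine lintegral_congr fun ω => ?_
    by_cases hω : Z ω < ⊤
    · rw [indicator_of_mem (s := {ω | Z ω < ⊤}) hω]
    · have htop : Z ω = ⊤ := not_lt_top_iff.mp hω
      by_cases hωA : ω ∈ A <;> simp [htop, hωA]
  rw [hrestrict, ← lintegral_trim hm hf, htrim, lintegral_trim hm hf, lintegral_smul_measure,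
    lintegral_withDensity_eq_lintegral_mul _ hZ0 hf0, smul_eq_mul, ← mul_assoc,
    ENNReal.mul_inv_cancel hx0 hxt, one_mul, ← lintegral_indicator_one (hm _ hA)]
  refine lintegral_congr_ae ?_
  filter_upwards [hpos] with ω hω
  by_cases hωA : ω ∈ A
  · simp [hωA, ENNReal.mul_inv_cancel hω.1 hω.2]
  · simp [hωA]

/-- A common measurable hull of a set for two measures. -/
lemma exists_common_measurable_hull {Ω : Type*} {m0 : MeasurableSpace Ω} (P Q : Measure Ω)
    [IsFiniteMeasure P] (A : Set Ω) : ∃ H, MeasurableSet H ∧ A ⊆ H ∧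
      ∀ B, A ⊆ B → B ⊆ H → Q A = Q B ∧ P.restrict A = P.restrict B := by
  refine ⟨toMeasurable Q A ∩ toMeasurable P A,
    (measurableSet_toMeasurable Q A).inter (measurableSet_toMeasurable P A),
    subset_inter (subset_toMeasurable Q A) (subset_toMeasurable P A), fun B hAB hBH => ⟨?_, ?_⟩⟩
  · exact le_antisymm (measure_mono hAB)
      ((measure_mono (hBH.trans inter_subset_left)).trans (measure_toMeasurable A).le)
  · refine le_antisymm (Measure.restrict_mono hAB le_rfl) ?_
    rw [← Measure.restrict_toMeasurable (measure_ne_top P A)]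
    exact Measure.restrict_mono (hBH.trans inter_subset_right) le_rfl

section StoppingTimes

variable {Ω : Type*} {F : ℝ → MeasurableSpace Ω} {T : ℝ} {X : ℝ → Ω → ℝ≥0∞} {τ : Ω → ℝ}

lemma IsStopT.nonneg (hT : 0 < T) (hτ : IsStopT F T τ) (ω : Ω) : 0 ≤ τ ω := by
  rcases hτ.2 ω with h | h
  · exact h.1
  · rw [mem_singleton_iff.mp h]; linarith

lemma IsStopT.measurableSet_lt (hτ : IsStopT F T τ) (t : ℝ) :
    MeasurableSet[F t] {ω | t < τ ω} := by
  convert (hτ.1 t).compl using 1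
  ext ω
  simp

lemma IsStopT.measurable_min (hmono : ∀ s t : ℝ, s ≤ t → F s ≤ F t) (hτ : IsStopT F T τ)
    (t : ℝ) : Measurable[F t] fun ω => min (τ ω) t := by
  refine measurable_of_Iic fun a => ?_
  rcases le_or_gt t a with h | h
  · convert @MeasurableSet.univ _ (F t) using 1
    ext ω
    simp [h]
  · convert hmono a t h.le _ (hτ.1 a) using 1
    ext ω
    simp [not_le.mpr h]

/-- The events of `F_T` which belong to `F_τ`. -/
abbrev stoppedSpace (F : ℝ → MeasurableSpace Ω) (T : ℝ) (τ : Ω → ℝ) (hτ : IsStopT F T τ) :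
    MeasurableSpace Ω where
  MeasurableSet' A := MeasurableSet[F T] A ∧ MemFtau F τ A
  measurableSet_empty := ⟨@MeasurableSet.empty _ (F T), fun t => by simp⟩
  measurableSet_compl A hA := ⟨hA.1.compl, fun t => by
    convert (hτ.1 t).diff (hA.2 t) using 1
    ext ω
    simp only [mem_inter_iff, mem_compl_iff, mem_ofPred_eq, Set.mem_sdiff]
    tauto⟩
  measurableSet_iUnion f hf := ⟨MeasurableSet.iUnion fun i => (hf i).1, fun t => by
    rw [iUnion_inter]
    exact MeasurableSet.iUnion fun i => (hf i).2 t⟩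

lemma measurableSet_stoppedSpace {hτ : IsStopT F T τ} {A : Set Ω} :
    MeasurableSet[stoppedSpace F T τ hτ] A ↔ MeasurableSet[F T] A ∧ MemFtau F τ A := Iff.rfl

/-- A continuous adapted process evaluated at a stopping time before `t` is `F_t`-measurable. -/
lemma IsStopT.measurable_eval_min (hT : 0 < T) (hmono : ∀ s t : ℝ, s ≤ t → F s ≤ F t)
    (hX : ∀ t ∈ Icc (0:ℝ) T, Measurable[F t] (X t))
    (hc : ∀ ω, ContinuousOn (fun t => X t ω) (Icc 0 T)) (hτ : IsStopT F T τ)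
    {t : ℝ} (ht : t ∈ Icc 0 T) : Measurable[F t] fun ω => X (min (τ ω) t) ω := by
  let _ : MeasurableSpace Ω := F t
  have hu : Measurable (Function.uncurry fun (s : ℝ) ω => X (max 0 (min s t)) ω) := by
    refine measurable_uncurry_of_continuous_of_measurable (fun ω => ?_) (fun s => ?_)
    · exact (hc ω).comp_continuous (by fun_prop) fun s =>
        ⟨le_max_left _ _, max_le hT.le ((min_le_right _ _).trans ht.2)⟩
    · have hs : max 0 (min s t) ≤ t := max_le ht.1 (min_le_right _ _)
      exact (hX _ ⟨le_max_left _ _, hs.trans ht.2⟩).mono (hmono _ _ hs) le_rfl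
  have hcomp := hu.comp ((hτ.measurable_min hmono t).prodMk measurable_id)
  convert hcomp using 1
  funext ω
  simp [Function.uncurry, max_eq_right (le_min (hτ.nonneg hT ω) ht.1)]

lemma IsStopT.measurable_valueAt (hT : 0 < T) (hmono : ∀ s t : ℝ, s ≤ t → F s ≤ F t)
    (hX : ∀ t ∈ Icc (0:ℝ) T, Measurable[F t] (X t))
    (hc : ∀ ω, ContinuousOn (fun t => X t ω) (Icc 0 T)) (hτ : IsStopT F T τ) :
    Measurable[stoppedSpace F T τ hτ] (valueAt T X τ) := by
  have hmeas := hτ.measurable_eval_min hT hmono hX hc (right_mem_Icc.mpr hT.le)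
  intro B hB
  refine measurableSet_stoppedSpace.mpr ⟨hmeas hB, fun t => ?_⟩
  rcases lt_or_ge t 0 with h0 | h0
  · convert @MeasurableSet.empty _ (F t) using 1
    ext ω
    simpa using fun _ => h0.trans_le (hτ.nonneg hT ω)
  rcases le_or_gt t T with h1 | h1
  · convert ((hτ.measurable_eval_min hT hmono hX hc ⟨h0, h1⟩) hB).inter (hτ.1 t) using 1
    ext ω
    simp only [mem_inter_iff, mem_preimage, mem_ofPred_eq, valueAt]
    refine and_congr_left fun h => ?_
    rw [min_eq_left h, min_eq_left (h.trans h1)]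
  · exact (hmono T t h1.le _ (hmeas hB)).inter (hτ.1 t)

lemma IsStopT.min_const (hT : 0 < T)
    (hτ : IsStopT F T τ) {t : ℝ} (ht : t ∈ Icc 0 T) : IsStopT F T fun ω => min t (τ ω) := by
  refine ⟨fun a => ?_, fun ω => Or.inl ⟨le_min ht.1 (hτ.nonneg hT ω),
    (min_le_left _ _).trans ht.2⟩⟩
  rcases le_or_gt t a with h | h
  · convert @MeasurableSet.univ _ (F a) using 1
    ext ω
    simp [h]
  · convert hτ.1 a using 1
    ext ω
    simp [not_le.mpr h]

end StoppingTimes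

section HittingTimes

variable {Ω : Type*} {F : ℝ → MeasurableSpace Ω} {T : ℝ} {X : ℝ → Ω → ℝ≥0∞} {c : ℝ≥0∞} {ω : Ω}

lemma hitBelow_mem (hT : 0 < T) (hc : ContinuousOn (fun t => X t ω) (Icc 0 T)) :
    hitBelow T X c ω ∈ {t ∈ Icc (0:ℝ) T | X t ω ≤ c} ∪ {T + 1} := by
  refine IsClosed.csInf_mem ?_ ⟨T + 1, Or.inr rfl⟩ ⟨0, ?_⟩
  · exact (hc.preimage_isClosed_of_isClosed isClosed_Icc isClosed_Iic).union isClosed_singleton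
  · rintro t (h | h)
    · exact h.1.1
    · rw [mem_singleton_iff.mp h]; linarith

lemma hitBelow_le_of_le (hT : 0 < T) {t : ℝ} (ht : t ∈ Icc 0 T) (h : X t ω ≤ c) :
    hitBelow T X c ω ≤ t := by
  refine csInf_le ⟨0, ?_⟩ (Or.inl ⟨ht, h⟩)
  rintro t (h | h)
  · exact h.1.1
  · rw [mem_singleton_iff.mp h]; linarith

lemma hitBelow_le_iff (hT : 0 < T) (hc : ContinuousOn (fun t => X t ω) (Icc 0 T)) {t : ℝ}
    (ht : t ≤ T) : hitBelow T X c ω ≤ t ↔ ∃ s ∈ Icc 0 t, X s ω ≤ c := by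
  constructor
  · intro h
    rcases hitBelow_mem (c := c) hT hc with hm | hm
    · exact ⟨_, ⟨hm.1.1, h⟩, hm.2⟩
    · rw [mem_singleton_iff.mp hm] at h
      linarith
  · rintro ⟨s, hs, hsc⟩
    exact (hitBelow_le_of_le hT ⟨hs.1, hs.2.trans ht⟩ hsc).trans hs.2

lemma isStopT_hitBelow (hT : 0 < T) (hmono : ∀ s t : ℝ, s ≤ t → F s ≤ F t)
    (hX : ∀ t ∈ Icc (0:ℝ) T, Measurable[F t] (X t))
    (hc : ∀ ω, ContinuousOn (fun t => X t ω) (Icc 0 T)) (c : ℝ≥0∞) :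
    IsStopT F T (hitBelow T X c) := by
  have key : ∀ t ∈ Icc 0 T, MeasurableSet[F t] {ω | hitBelow T X c ω ≤ t} := by
    intro t ht
    have : Nonempty (Icc 0 t) := ⟨⟨0, left_mem_Icc.mpr ht.1⟩⟩
    let d := TopologicalSpace.denseSeq (Icc 0 t)
    have hinf : Measurable[F t] fun ω => ⨅ n, X (d n) ω :=
      Measurable.iInf fun n =>
        (hX _ ⟨(d n).2.1, (d n).2.2.trans ht.2⟩).mono (hmono _ _ (d n).2.2) le_rfl
    convert hinf (measurableSet_Iic (a := c)) using 1
    ext ω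
    rw [mem_ofPred_eq, hitBelow_le_iff hT (hc ω) ht.2, mem_preimage, mem_Iic]
    have hct : ContinuousOn (fun s => X s ω) (Icc 0 t) :=
      (hc ω).mono (Icc_subset_Icc le_rfl ht.2)
    constructor
    · rintro ⟨s, hs, hsc⟩
      by_contra! hlt
      have hopen : IsOpen {r : Icc 0 t | X r ω < ⨅ n, X (d n) ω} :=
        isOpen_Iio.preimage hct.domRestrict
      obtain ⟨n, hn⟩ := (TopologicalSpace.denseRange_denseSeq (Icc 0 t)).exists_mem_open hopen
        ⟨⟨s, hs⟩, hsc.trans_lt hlt⟩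
      exact (iInf_le (fun n => X (d n) ω) n).not_gt hn
    · intro h
      obtain ⟨s, hs, hmin⟩ := isCompact_Icc.exists_isMinOn (nonempty_Icc.mpr ht.1) hct
      exact ⟨s, hs, (le_iInf fun n => hmin (d n).2).trans h⟩
  have hval : ∀ ω, hitBelow T X c ω ∈ Icc (0:ℝ) T ∪ {T + 1} := fun ω =>
    (hitBelow_mem hT (hc ω)).imp (fun h => h.1) id
  refine ⟨fun t => ?_, hval⟩
  rcases lt_or_ge t 0 with h0 | h0
  · convert @MeasurableSet.empty _ (F t) using 1
    ext ω
    rcases hval ω with h | h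
    · simpa using h0.trans_le h.1
    · have := mem_singleton_iff.mp h
      simp only [mem_ofPred_eq, mem_empty_iff_false, iff_false, not_le]
      linarith
  rcases le_or_gt t T with h1 | h1
  · exact key t ⟨h0, h1⟩
  rcases lt_or_ge t (T + 1) with h2 | h2
  · convert hmono T t h1.le _ (key T (right_mem_Icc.mpr hT.le)) using 1
    ext ω
    rcases hval ω with h | h
    · simp [h.2, h.2.trans h1.le]
    · have := mem_singleton_iff.mp h
      rw [mem_ofPred_eq, mem_ofPred_eq, this]
      constructor <;> intro <;> linarith
  · convert @MeasurableSet.univ _ (F t) using 1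
    ext ω
    rcases hval ω with h | h
    · simpa using h.2.trans h1.le
    · simpa [mem_singleton_iff.mp h] using h2

/-- Up to the hitting time of `[0,c]`, the process is bounded below by `min (X 0) c`. -/
lemma min_le_of_le_hitBelow (hT : 0 < T) (hc : ContinuousOn (fun t => X t ω) (Icc 0 T))
    {s : ℝ} (hs : s ∈ Icc 0 T) (hle : s ≤ hitBelow T X c ω) : min (X 0 ω) c ≤ X s ω := by
  rcases hs.1.eq_or_lt with rfl | hpos
  · exact min_le_left _ _
  refine (min_le_right _ _).trans ?_
  have hcs : ContinuousOn (fun t => X t ω) (closure (Ico 0 s)) := by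
    rw [closure_Ico hpos.ne]
    exact hc.mono (Icc_subset_Icc le_rfl hs.2)
  refine ContinuousWithinAt.closure_le (f := fun _ => c) (g := fun t => X t ω)
    (s := Ico 0 s) (x := s) ?_ continuousWithinAt_const ?_ ?_
  · rw [closure_Ico hpos.ne]; exact right_mem_Icc.mpr hpos.le
  · exact (hc s hs).mono fun r hr => ⟨hr.1, hr.2.le.trans hs.2⟩
  · intro r hr
    by_contra! hlt
    exact (hitBelow_le_of_le hT ⟨hr.1, hr.2.le.trans hs.2⟩ hlt.le).not_gt (hr.2.trans_le hle)

lemma hitBelow_mono {c' : ℝ≥0∞} (hT : 0 < T) (h : c' ≤ c) :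
    hitBelow T X c ω ≤ hitBelow T X c' ω := by
  refine csInf_le_csInf ⟨0, ?_⟩ ⟨T + 1, Or.inr rfl⟩ ?_
  · rintro t (h | h)
    · exact h.1.1
    · rw [mem_singleton_iff.mp h]; linarith
  · exact union_subset_union_left _ fun t ht => ⟨ht.1, ht.2.trans h⟩

/-- A path that does not end at the absorbing state `0` stays away from `0`. -/
lemma eventually_hitBelow_eq (hT : 0 < T) (hc : ContinuousOn (fun t => X t ω) (Icc 0 T))
    (habs : ∀ t ∈ Icc (0:ℝ) T, X t ω = 0 → X T ω = 0) (h : X T ω ≠ 0) :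
    ∀ᶠ n : ℕ in atTop, hitBelow T X ((n : ℝ≥0∞))⁻¹ ω = T + 1 := by
  obtain ⟨t, ht, hmin⟩ := isCompact_Icc.exists_isMinOn (nonempty_Icc.mpr hT.le) hc
  obtain ⟨n, hn⟩ := ENNReal.exists_inv_nat_lt fun h0 : X t ω = 0 => h (habs t ht h0)
  filter_upwards [eventually_ge_atTop n] with k hk
  rcases hitBelow_mem (c := ((k : ℝ≥0∞))⁻¹) hT hc with hm | hm
  · have hkn : ((k : ℝ≥0∞))⁻¹ ≤ ((n : ℝ≥0∞))⁻¹ := ENNReal.inv_le_inv.mpr (by exact_mod_cast hk)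
    exact absurd ((hmin hm.1).trans (hm.2.trans hkn)) hn.not_ge
  · exact hm

lemma hitAbove_le_of_le (hT : 0 < T) {t : ℝ} (ht : t ∈ Icc 0 T) (h : c ≤ X t ω) :
    hitAbove T X c ω ≤ t := by
  refine csInf_le ⟨0, ?_⟩ (Or.inl ⟨ht, h⟩)
  rintro t (h | h)
  · exact h.1.1
  · rw [mem_singleton_iff.mp h]; linarith

lemma Rt_le_of_eq_top (hT : 0 < T) (h : X T ω = ⊤) : Rt T X ω ≤ T :=
  ciSup_le fun _ => hitAbove_le_of_le hT (right_mem_Icc.mpr hT.le) (h ▸ le_top)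

lemma St_eq_of_eventually (hT : 0 < T) (hc : ContinuousOn (fun t => X t ω) (Icc 0 T))
    (h : ∀ᶠ n : ℕ in atTop, hitBelow T X ((n : ℝ≥0∞))⁻¹ ω = T + 1) : St T X ω = T + 1 := by
  have hle : ∀ n : ℕ, hitBelow T X ((n : ℝ≥0∞))⁻¹ ω ≤ T + 1 := fun n => by
    rcases hitBelow_mem (c := ((n : ℝ≥0∞))⁻¹) hT hc with hm | hm
    · linarith [hm.1.2]
    · exact hm.le
  obtain ⟨n, hn⟩ := h.exists
  refine le_antisymm (ciSup_le hle) ?_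
  rw [← hn]
  exact le_ciSup (f := fun n : ℕ => hitBelow T X ((n : ℝ≥0∞))⁻¹ ω)
    ⟨T + 1, forall_mem_range.mpr hle⟩ n

end HittingTimes

section Numeraire

variable {Ω : Type*} {F : ℝ → MeasurableSpace Ω} {T : ℝ} {X : ℝ → Ω → ℝ≥0∞} {x₀ : ℝ≥0∞}
  {Q Qh : @Measure Ω (F T)}

lemma Setup.ae_ne_top (h : Setup F T X x₀ Q) : ∀ᵐ ω ∂Q, X T ω ≠ ⊤ := by
  have := h.prob
  have hT := right_mem_Icc.mpr h.T_pos.le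
  have hmeas : MeasurableSet[F T] {ω | X T ω ≠ ⊤} :=
    (h.adapted T hT (measurableSet_singleton ⊤)).compl
  refine (mem_ae_iff_prob_eq_one hmeas).mpr (le_antisymm prob_le_one ?_)
  rw [← h.noExplosion]
  refine measure_mono fun ω hω htop => ?_
  have := Rt_le_of_eq_top h.T_pos htop
  rw [mem_ofPred_eq] at hω
  linarith

lemma Setup.ae_init (h : Setup F T X x₀ Q) : ∀ᵐ ω ∂Q, X 0 ω = x₀ := by
  have := h.prob
  have hmeas : MeasurableSet[F T] {ω | X 0 ω = x₀} :=
    h.mono 0 T h.T_pos.le _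
      (h.adapted 0 (left_mem_Icc.mpr h.T_pos.le) (measurableSet_singleton x₀))
  exact (mem_ae_iff_prob_eq_one hmeas).mpr h.init

/-- Change of measure at a stopping time dominated by a hitting time of `[0,c]`. -/
lemma NumeraireRel.measure_eq (hnum : NumeraireRel F T X x₀ Q Qh) (h : Setup F T X x₀ Q)
    {c : ℝ≥0∞} (hc : c ≠ 0) {τ : Ω → ℝ} (hτ : IsStopT F T τ)
    (hle : ∀ ω, τ ω ≤ hitBelow T X c ω) {A : Set Ω} (hA : MeasurableSet[F T] A)
    (hAτ : MemFtau F τ A) : Q A = x₀ * ∫⁻ ω in A, (valueAt T X τ ω)⁻¹ ∂Qh := by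
  refine measure_eq_mul_setLIntegral_inv (m := stoppedSpace F T τ hτ) (fun _ hB => hB.1)
    (hτ.measurable_valueAt h.T_pos h.mono h.adapted h.contPaths) h.x₀_pos.ne' h.x₀_lt_top.ne
    (fun B hB => hnum τ hτ B hB.2) ?_ ⟨hA, hAτ⟩
  filter_upwards [h.ae_ne_top, h.ae_init] with ω htop hinit
  have hmem : min (τ ω) T ∈ Icc 0 T :=
    ⟨le_min (hτ.nonneg h.T_pos ω) h.T_pos.le, min_le_right _ _⟩
  constructor
  · have hlow := min_le_of_le_hitBelow (c := c) h.T_pos (h.contPaths ω) hmem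
      ((min_le_left _ _).trans (hle ω))
    rw [hinit] at hlow
    exact ((lt_min h.x₀_pos (pos_iff_ne_zero.mpr hc)).trans_le hlow).ne'
  · intro hv
    refine htop ((h.absorbing ω _ hmem (Or.inr hv) T ⟨min_le_right _ _, le_rfl⟩).trans hv)

lemma NumeraireRel.isMart_stopped_inv (hnum : NumeraireRel F T X x₀ Q Qh)
    (h : Setup F T X x₀ Q) {c : ℝ≥0∞} (hc : c ≠ 0) :
    IsMart F T Qh (stopped T (fun t ω => (X t ω)⁻¹) (hitBelow T X c)) := by
  have hprob := h.prob
  have hS := isStopT_hitBelow h.T_pos h.mono h.adapted h.contPaths c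
  have hval : ∀ t ∈ Icc 0 T, ∀ ω, stopped T (fun t ω => (X t ω)⁻¹) (hitBelow T X c) t ω
      = (valueAt T X (fun ω => min t (hitBelow T X c ω)) ω)⁻¹ := fun t _ ω => by
    simp only [stopped, valueAt, min_assoc]
  have hmeasure : ∀ t ∈ Icc 0 T, ∀ A, MeasurableSet[F T] A →
      MemFtau F (fun ω => min t (hitBelow T X c ω)) A →
      Q A = x₀ * ∫⁻ ω in A, stopped T (fun t ω => (X t ω)⁻¹) (hitBelow T X c) t ω ∂Qh := by
    intro t ht A hA hAt
    rw [hnum.measure_eq h hc (hS.min_const h.T_pos ht) (fun _ => min_le_right _ _) hA hAt]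
    simp only [hval t ht]
  refine ⟨fun t ht => ?_, fun t ht htop => ?_, fun s t hs hst htT A hA => ?_⟩
  · have hm := (hS.measurable_eval_min h.T_pos h.mono h.adapted h.contPaths ht).inv
    convert hm using 1
    funext ω
    simp only [stopped, Pi.inv_apply]
    rw [min_comm (hitBelow T X c ω) T, ← min_assoc, min_eq_left ht.2, min_comm]
  · have huniv := hmeasure t ht univ (@MeasurableSet.univ _ (F T)) fun a => by
      simpa using (hS.min_const h.T_pos ht).1 a
    rw [Measure.restrict_univ, htop, measure_univ, ENNReal.mul_top h.x₀_pos.ne'] at huniv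
    exact ENNReal.one_ne_top huniv
  · have hsT : s ∈ Icc 0 T := ⟨hs, hst.trans htT⟩
    have hgt : MeasurableSet[F s] {ω | s < hitBelow T X c ω} := hS.measurableSet_lt s
    have hB : MeasurableSet[F T] (A ∩ {ω | s < hitBelow T X c ω}) :=
      h.mono s T hsT.2 _ (hA.inter hgt)
    have hmem : ∀ r ∈ Icc s T, MemFtau F (fun ω => min r (hitBelow T X c ω))
        (A ∩ {ω | s < hitBelow T X c ω}) := by
      intro r hr a
      rcases lt_or_ge a s with ha | ha
      · convert @MeasurableSet.empty _ (F a) using 1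
        ext ω
        simp only [mem_inter_iff, mem_ofPred_eq, mem_empty_iff_false, iff_false, not_and, not_le]
        exact fun hω => lt_min (ha.trans_le hr.1) (ha.trans hω.2)
      · exact (h.mono s a ha _ (hA.inter hgt)).inter
          ((hS.min_const h.T_pos ⟨hs.trans hr.1, hr.2⟩).1 a)
    have hsplit := fun f : Ω → ℝ≥0∞ => lintegral_inter_add_sdiff (μ := Qh) f A
      (h.mono s T hsT.2 _ hgt)
    rw [← hsplit, ← hsplit]
    congr 1
    · have heq := (hmeasure t ⟨hs.trans hst, htT⟩ _ hB (hmem t ⟨hst, htT⟩)).symm.trans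
        (hmeasure s hsT _ hB (hmem s ⟨le_rfl, hsT.2⟩))
      exact (ENNReal.mul_right_inj h.x₀_pos.ne' h.x₀_lt_top.ne).mp heq
    · refine setLIntegral_congr_fun (h.mono s T hsT.2 _ (hA.diff hgt)) fun ω hω => ?_
      have hω' : hitBelow T X c ω ≤ s := not_lt.mp hω.2
      simp only [stopped]
      rw [min_eq_right ((min_le_left _ _).trans (hω'.trans hst)),
        min_eq_right ((min_le_left _ _).trans hω')]

/-- The density formula on `F_τ`, also for events of `F_τ` outside `F_T`, where both sides are
computed from a common measurable hull. -/
lemma NumeraireRel.measure_eq_of_memFtau (hnum : NumeraireRel F T X x₀ Q Qh)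
    (h : Setup F T X x₀ Q) [IsFiniteMeasure Qh] {c : ℝ≥0∞} (hc : c ≠ 0) {A : Set Ω}
    (hA : MemFtau F (hitBelow T X c) A) :
    Q A = x₀ * ∫⁻ ω in A, (valueAt T X (hitBelow T X c) ω)⁻¹ ∂Qh := by
  have hS := isStopT_hitBelow h.T_pos h.mono h.adapted h.contPaths c
  obtain ⟨H, hH, hAH, hhull⟩ := exists_common_measurable_hull Qh Q A
  let D : Set Ω := {ω | hitBelow T X c ω ≤ T}
  let B : Set Ω := A ∩ D ∪ H \ D
  have hD : MeasurableSet[F T] D := hS.1 T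
  have hB : MeasurableSet[F T] B := (hA T).union (hH.diff hD)
  have hAB : A ⊆ B := fun ω hω => by
    by_cases hωD : ω ∈ D
    · exact Or.inl ⟨hω, hωD⟩
    · exact Or.inr ⟨hAH hω, hωD⟩
  have hBH : B ⊆ H := union_subset (inter_subset_left.trans hAH) sdiff_subset
  have hBF : MemFtau F (hitBelow T X c) B := by
    intro t
    rcases le_or_gt t T with ht | ht
    · convert hA t using 1
      ext ω
      have hωD : hitBelow T X c ω ≤ t → ω ∈ D := fun hω => hω.trans ht
      simp only [B, mem_inter_iff, mem_union, Set.mem_sdiff, mem_ofPred_eq]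
      tauto
    · exact (h.mono T t ht.le _ hB).inter (hS.1 t)
  obtain ⟨hQ, hQh⟩ := hhull B hAB hBH
  rw [hQ, hQh]
  exact hnum.measure_eq h hc hS (fun _ => le_rfl) hB hBF

lemma NumeraireRel.measure_setOf_eq_zero (hnum : NumeraireRel F T X x₀ Q Qh)
    (h : Setup F T X x₀ Q) :
    Qh {ω | X T ω = 0} = 0 := by
  have hτ : IsStopT F T fun _ => T := ⟨fun t => by
    by_cases ht : T ≤ t
    · simp [ht]
    · simp [ht], fun _ => Or.inl (right_mem_Icc.mpr h.T_pos.le)⟩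
  have hmeas : MeasurableSet[F T] {ω | X T ω = 0} :=
    h.adapted T (right_mem_Icc.mpr h.T_pos.le) (measurableSet_singleton 0)
  have hmem : MemFtau F (fun _ : Ω => T) {ω | X T ω = 0} := fun t => by
    by_cases ht : T ≤ t
    · simpa [ht] using h.mono T t ht _ hmeas
    · simp [ht]
  have hrel := hnum _ hτ _ hmem
  have hzero : ∫⁻ ω in {ω | X T ω = 0}, valueAt T X (fun _ => T) ω ∂Q = 0 := by
    rw [setLIntegral_congr_fun (g := fun _ => 0) hmeas fun ω hω => by
      simpa [valueAt] using hω]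
    simp
  rw [hzero, ENNReal.zero_div] at hrel
  convert hrel using 2
  ext ω
  simp only [mem_inter_iff, mem_ofPred_eq, valueAt, min_self, iff_self_and]
  exact fun hω => by simp [hω]

end Numeraire

/-- Properties of the numéraire measure.  If `Q̂` satisfies the
numéraire relation, then (a) `Q̂(S = T+1) = 1`; (b) `1/X` is a `Q̂`-local martingale and
the stopped process `(1/X)^{S_i}` is a `Q̂`-martingale for every `i`; (c) for every `i`,
`Q ≪ Q̂` on `F_{S_i}` with density `x₀ / X_{S_i ∧ T}`. -/
theorem statement3 {Ω : Type*} (F : ℝ → MeasurableSpace Ω) (T : ℝ)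
    (X : ℝ → Ω → ℝ≥0∞) (x₀ : ℝ≥0∞) (Q Qh : @Measure Ω (F T))
    (hsetup : Setup F T X x₀ Q) (hQh : IsProbabilityMeasure Qh)
    (hnum : NumeraireRel F T X x₀ Q Qh) :
    Qh {ω | St T X ω = T + 1} = 1 ∧
    IsLocMart F T Qh (fun t ω => (X t ω)⁻¹) ∧
    (∀ i : ℕ, IsMart F T Qh
      (stopped T (fun t ω => (X t ω)⁻¹) (hitBelow T X ((i : ℝ≥0∞))⁻¹))) ∧
    ∀ i : ℕ, ∀ A : Set Ω, MemFtau F (hitBelow T X ((i : ℝ≥0∞))⁻¹) A →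
      Q A = x₀ * ∫⁻ ω in A, (valueAt T X (hitBelow T X ((i : ℝ≥0∞))⁻¹) ω)⁻¹ ∂Qh := by
  have hc : ∀ i : ℕ, ((i : ℝ≥0∞))⁻¹ ≠ 0 := fun i => ENNReal.inv_ne_zero.mpr (by simp)
  have hev : ∀ ω ∈ {ω | X T ω = 0}ᶜ,
      ∀ᶠ n : ℕ in atTop, hitBelow T X ((n : ℝ≥0∞))⁻¹ ω = T + 1 := fun ω hω =>
    eventually_hitBelow_eq hsetup.T_pos (hsetup.contPaths ω)
      (fun t ht h0 => (hsetup.absorbing ω t ht (Or.inl h0) T ⟨ht.2, le_rfl⟩).trans h0) hω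
  have hone : ∀ E : Set Ω, {ω | X T ω = 0}ᶜ ⊆ E → Qh E = 1 := fun E hE => by
    refine le_antisymm prob_le_one ?_
    rw [← (prob_compl_eq_one_iff (hsetup.adapted T (right_mem_Icc.mpr hsetup.T_pos.le)
      (measurableSet_singleton 0))).mpr (hnum.measure_setOf_eq_zero hsetup)]
    exact measure_mono hE
  refine ⟨hone _ fun ω hω => St_eq_of_eventually hsetup.T_pos (hsetup.contPaths ω) (hev ω hω),
    ⟨fun n => hitBelow T X ((n : ℝ≥0∞))⁻¹, fun n => ?_, fun n ω => ?_, hone _ hev, fun n =>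
      hnum.isMart_stopped_inv hsetup (hc n)⟩,
    fun i => hnum.isMart_stopped_inv hsetup (hc i),
    fun i A hA => hnum.measure_eq_of_memFtau hsetup (hc i) hA⟩
  · exact isStopT_hitBelow hsetup.T_pos hsetup.mono hsetup.adapted hsetup.contPaths _
  · exact hitBelow_mono hsetup.T_pos (ENNReal.inv_le_inv.mpr (by exact_mod_cast n.le_succ))

end Paper
end
end

section
/- Let ρ and τ be stopping times with values in [0,T] satisfying ρ ≤ τ both Q-almost surely and Q̂-almost surely, and let Y be a nonnegative F_τ-measurable random variable such that E^Q[Y·1_{X_τ > 0}] < ∞ and E^{Q̂}[(Y/X_τ)·1_{0 < X_τ < ∞}] < ∞. Then, for any versions of the conditional expectations, the Bayes formula E^{Q̂}[(Y/X_τ)·1_{0 < X_τ < ∞} | F_ρ]·1_{X_ρ > 0} = E^Q[Y·1_{X_τ > 0} | F_ρ]·1_{0 < X_ρ < ∞}·(1/X_ρ) holds both Q-almost surely and Q̂-almost surely; moreover E^Q[Y·1_{X_τ > 0} | F_ρ] = 0 Q-almost surely on {X_ρ = 0}. -/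
open MeasureTheory Filter Set Topology
open scoped ENNReal NNReal

noncomputable section

namespace Paper

/-- `g` is a version of the conditional expectation `E^P[Y ∣ m]` for a nonnegative
random variable `Y`: `g` is `m`-measurable and satisfies the defining set-integral
identity on `m`-measurable sets. -/
def IsCondExpOf {Ω : Type*} {mΩ : MeasurableSpace Ω} (m : MeasurableSpace Ω)
    (P : @Measure Ω mΩ) (Y g : Ω → ℝ≥0∞) : Prop :=
  Measurable[m] g ∧
    ∀ A : Set Ω, MeasurableSet[m] A → ∫⁻ ω in A, g ω ∂P = ∫⁻ ω in A, Y ω ∂P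

section Bayes

variable {Ω : Type*} {m m' mΩ : MeasurableSpace Ω} {Q Qh : Measure Ω} {c : ℝ≥0∞}
  {U V : Ω → ℝ≥0∞}

lemma setLIntegral_inter_lt_top_eq_of_density (hm : m ≤ mΩ) (hU : Measurable[m] U)
    (hnum : ∀ A, MeasurableSet[m] A → Qh (A ∩ {ω | U ω < ⊤}) = (∫⁻ ω in A, U ω ∂Q) / c)
    {f : Ω → ℝ≥0∞} (hf : Measurable[m] f) {A : Set Ω} (hA : MeasurableSet[m] A) :
    ∫⁻ ω in A ∩ {ω | U ω < ⊤}, f ω ∂Qh = (∫⁻ ω in A, f ω * U ω ∂Q) / c := by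
  have hU' : Measurable U := hU.mono hm le_rfl
  have hf' : Measurable f := hf.mono hm le_rfl
  have htrim : (Qh.restrict {ω | U ω < ⊤}).trim hm = (c⁻¹ • Q.withDensity U).trim hm := by
    refine @Measure.ext _ m _ _ fun B hB ↦ ?_
    rw [trim_measurableSet_eq hm hB, trim_measurableSet_eq hm hB,
      Measure.restrict_apply (hm _ hB), hnum B hB, Measure.smul_apply,
      withDensity_apply _ (hm _ hB), smul_eq_mul, ENNReal.div_eq_inv_mul]
  have hind : Measurable[m] (A.indicator f) := hf.indicator hA
  calc ∫⁻ ω in A ∩ {ω | U ω < ⊤}, f ω ∂Qh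
      = ∫⁻ ω, A.indicator f ω ∂(Qh.restrict {ω | U ω < ⊤}) := by
        rw [lintegral_indicator (hm _ hA), Measure.restrict_restrict (hm _ hA)]
    _ = ∫⁻ ω, A.indicator f ω ∂(c⁻¹ • Q.withDensity U) := by
        rw [← lintegral_trim hm hind, htrim, lintegral_trim hm hind]
    _ = (∫⁻ ω in A, f ω * U ω ∂Q) / c := by
        rw [lintegral_smul_measure, lintegral_indicator (hm _ hA),
          setLIntegral_withDensity_eq_setLIntegral_mul _ hU' hf' (hm _ hA), smul_eq_mul,
          ENNReal.div_eq_inv_mul]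
        simp only [Pi.mul_apply, mul_comm]

lemma ae_lt_top_of_density [IsFiniteMeasure Qh] (hm : m ≤ mΩ) (hU : Measurable[m] U)
    (hc : c ≠ ⊤)
    (hnum : ∀ A, MeasurableSet[m] A → Qh (A ∩ {ω | U ω < ⊤}) = (∫⁻ ω in A, U ω ∂Q) / c) :
    ∀ᵐ ω ∂Q, U ω < ⊤ := by
  refine ae_lt_top (hU.mono hm le_rfl) fun htop ↦ ?_
  have h := hnum univ MeasurableSet.univ
  rw [Measure.restrict_univ, htop, ENNReal.top_div_of_ne_top hc] at h
  exact measure_ne_top _ _ h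

/-- Conditional expectations at two different σ-algebras are intertwined by the density. -/
lemma setLIntegral_condExp_eq [IsFiniteMeasure Qh] (hm' : m' ≤ mΩ)
    (hV : Measurable[m'] V) (hc : c ≠ ⊤)
    (hnum : ∀ A, MeasurableSet[m'] A → Qh (A ∩ {ω | V ω < ⊤}) = (∫⁻ ω in A, V ω ∂Q) / c)
    {Y : Ω → ℝ≥0∞} (hY : Measurable[m'] Y) {A B : Set Ω} (hB : MeasurableSet[m'] B)
    (hAB : A =ᵐ[Q] B) (hABh : A =ᵐ[Qh] B) :
    ∫⁻ ω in A, {ω | 0 < V ω ∧ V ω < ⊤}.indicator (fun ω ↦ Y ω / V ω) ω ∂Qh =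
      (∫⁻ ω in A, {ω | 0 < V ω}.indicator Y ω ∂Q) / c := by
  rw [setLIntegral_congr hABh, setLIntegral_congr hAB]
  set f : Ω → ℝ≥0∞ := {ω | 0 < V ω ∧ V ω < ⊤}.indicator (fun ω ↦ Y ω / V ω) with hf_def
  have hlt : MeasurableSet[m'] {ω | V ω < ⊤} := hV measurableSet_Iio
  have hf : Measurable[m'] f :=
    (Measurable.div hY hV).indicator ((hV measurableSet_Ioi).inter hlt)
  have hf_eq : {ω | V ω < ⊤}.indicator f = f := by
    rw [hf_def, Set.indicator_indicator]
    congr 1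
    ext ω
    simp
  calc ∫⁻ ω in B, f ω ∂Qh = ∫⁻ ω in B ∩ {ω | V ω < ⊤}, f ω ∂Qh := by
        conv_lhs => rw [← hf_eq]
        rw [setLIntegral_indicator (hm' _ hlt), inter_comm]
    _ = (∫⁻ ω in B, f ω * V ω ∂Q) / c :=
        setLIntegral_inter_lt_top_eq_of_density hm' hV hnum hf hB
    _ = (∫⁻ ω in B, {ω | 0 < V ω}.indicator Y ω ∂Q) / c := by
        congr 1
        refine lintegral_congr_ae (ae_restrict_of_ae ?_)
        filter_upwards [ae_lt_top_of_density hm' hV hc hnum] with ω hω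
        by_cases h0 : 0 < V ω
        · simp [hf_def, h0, hω, ENNReal.div_mul_cancel h0.ne' hω.ne]
        · simp [hf_def, h0]

/-- Bayes' formula for a single σ-algebra `m` on which `Qh` has density `U / c` with respect to
`Q` outside `{U = ∞}`. -/
lemma bayes_of_setLIntegral_eq [IsFiniteMeasure Q] [IsFiniteMeasure Qh] (hm : m ≤ mΩ)
    (hU : Measurable[m] U) (hc : c ≠ ⊤) (hc0 : c ≠ 0)
    (hnum : ∀ A, MeasurableSet[m] A → Qh (A ∩ {ω | U ω < ⊤}) = (∫⁻ ω in A, U ω ∂Q) / c)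
    {g h : Ω → ℝ≥0∞} (hg : Measurable[m] g) (hh : Measurable[m] h)
    (hgh : ∀ A, MeasurableSet[m] A → ∫⁻ ω in A, g ω ∂Qh = (∫⁻ ω in A, h ω ∂Q) / c) :
    (∀ᵐ ω ∂Q, {ω | 0 < U ω}.indicator g ω =
      {ω | 0 < U ω ∧ U ω < ⊤}.indicator (fun ω ↦ h ω / U ω) ω) ∧
    (∀ᵐ ω ∂Qh, {ω | 0 < U ω}.indicator g ω =
      {ω | 0 < U ω ∧ U ω < ⊤}.indicator (fun ω ↦ h ω / U ω) ω) ∧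
    (∀ᵐ ω ∂Q, U ω = 0 → h ω = 0) := by
  have hg' : Measurable g := hg.mono hm le_rfl
  have hh' : Measurable h := hh.mono hm le_rfl
  have hU' : Measurable U := hU.mono hm le_rfl
  have hlt : MeasurableSet[m] {ω | U ω < ⊤} := hU measurableSet_Iio
  have hUtop := ae_lt_top_of_density hm hU hc hnum
  have htop : MeasurableSet[m] {ω | U ω = ⊤} := hU (measurableSet_singleton ⊤)
  have hdiv_inj : ∀ a b : ℝ≥0∞, a / c = b / c → a = b := fun a b hab ↦ by
    rw [← ENNReal.div_mul_cancel (a := c) (b := a) hc0 hc, hab, ENNReal.div_mul_cancel hc0 hc]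
  -- `h = g U` holds `Q`-a.s.
  have hkey : ∀ᵐ ω ∂Q, h ω = g ω * U ω := by
    refine ae_eq_of_ae_eq_trim (hm := hm) (f₁ := h) (f₂ := fun ω ↦ g ω * U ω) ?_
    have hgU : Measurable[m] (fun ω ↦ g ω * U ω) := Measurable.mul hg hU
    refine @ae_eq_of_forall_setLIntegral_eq_of_sigmaFinite _ m _ _ _ _ hh hgU fun A hA _ ↦ ?_
    rw [setLIntegral_trim hm hh hA, setLIntegral_trim hm hgU hA]
    apply hdiv_inj
    have hAlt : (A ∩ {ω | U ω < ⊤} : Set Ω) =ᵐ[Q] A := by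
      filter_upwards [hUtop] with ω hω
      exact propext ⟨fun h ↦ h.1, fun h ↦ ⟨h, hω⟩⟩
    rw [← setLIntegral_inter_lt_top_eq_of_density hm hU hnum hg hA, hgh _ (hA.inter hlt),
      setLIntegral_congr hAlt]
  have hgtop : ∀ᵐ ω ∂Qh, U ω = ⊤ → g ω = 0 := by
    have hQ0 : Q {ω | U ω = ⊤} = 0 := by
      simpa [ae_iff] using hUtop
    have h0 := hgh _ htop
    rw [setLIntegral_measure_zero _ _ hQ0, ENNReal.zero_div] at h0
    rw [setLIntegral_eq_zero_iff (hm _ htop) hg'] at h0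
    exact h0
  have hac : ∀ {N : Set Ω}, MeasurableSet[m] N → Q N = 0 → Qh (N ∩ {ω | U ω < ⊤}) = 0 := by
    intro N hN hN0
    rw [hnum N hN, setLIntegral_measure_zero _ _ hN0, ENNReal.zero_div]
  have hkeyh : ∀ᵐ ω ∂Qh, U ω < ⊤ → h ω = g ω * U ω := by
    have hN : MeasurableSet[m] {ω | h ω = g ω * U ω}ᶜ :=
      (measurableSet_eq_fun hh (Measurable.mul hg hU)).compl
    have := hac hN (ae_iff.mp hkey)
    rw [ae_iff]
    refine measure_mono_null (fun ω hω ↦ ?_) this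
    simp only [mem_ofPred_eq, Classical.not_imp] at hω
    exact ⟨hω.2, hω.1⟩
  have hpt : ∀ ω, (U ω = ⊤ → g ω = 0) → (U ω < ⊤ → h ω = g ω * U ω) →
      {ω | 0 < U ω}.indicator g ω =
        {ω | 0 < U ω ∧ U ω < ⊤}.indicator (fun ω ↦ h ω / U ω) ω := by
    intro ω h1 h2
    by_cases h0 : 0 < U ω
    · by_cases ht : U ω < ⊤
      · simp [h0, ht, h2 ht, ENNReal.mul_div_cancel_right h0.ne' ht.ne]
      · simp [h0, ht, h1 (not_lt_top_iff.mp ht)]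
    · simp [h0]
  refine ⟨?_, ?_, ?_⟩
  · filter_upwards [hkey, hUtop] with ω h1 h2
    exact hpt ω (fun h ↦ absurd h h2.ne) fun _ ↦ h1
  · filter_upwards [hgtop, hkeyh] with ω h1 h2
    exact hpt ω h1 h2
  · filter_upwards [hkey] with ω h1 h0
    rw [h1, h0, mul_zero]

end Bayes

section StoppingTimes

variable {Ω : Type*} {F : ℝ → MeasurableSpace Ω} {T : ℝ} {σ : Ω → ℝ}

lemma measurableSet_sigmaAt (hσ : ∀ t, MeasurableSet[F t] {ω | σ ω ≤ t}) {A : Set Ω} :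
    MeasurableSet[sigmaAt F σ] A ↔ MemFtau F σ A := by
  refine ⟨fun hA ↦ ?_, fun hA ↦ MeasurableSpace.measurableSet_generateFrom hA⟩
  induction A, hA using MeasurableSpace.generateFrom_induction with
  | hC A hA _ => exact hA
  | empty => intro t; simp
  | compl A _ ih =>
    intro t
    have : Aᶜ ∩ {ω | σ ω ≤ t} = {ω | σ ω ≤ t} \ (A ∩ {ω | σ ω ≤ t}) := by
      ext ω
      simp only [mem_inter_iff, mem_compl_iff, mem_ofPred_eq, Set.mem_sdiff]
      tauto
    rw [this]
    exact (hσ t).diff (ih t)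
  | iUnion s _ ih =>
    intro t
    rw [iUnion_inter]
    exact MeasurableSet.iUnion fun n ↦ ih n t

lemma sigmaAt_le (hσ : ∀ t, MeasurableSet[F t] {ω | σ ω ≤ t}) (hσT : ∀ ω, σ ω ≤ T) :
    sigmaAt F σ ≤ F T := by
  intro A hA
  have h := (measurableSet_sigmaAt hσ).mp hA T
  rwa [show {ω | σ ω ≤ T} = univ from eq_univ_of_forall hσT, inter_univ] at h

lemma measurable_min_of_stopping (hF : ∀ s t, s ≤ t → F s ≤ F t)
    (hσ : ∀ t, MeasurableSet[F t] {ω | σ ω ≤ t}) (t : ℝ) :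
    Measurable[F t] fun ω ↦ min (σ ω) t := by
  refine measurable_of_Iic fun s ↦ ?_
  by_cases hs : t ≤ s
  · convert @MeasurableSet.univ _ (F t)
    ext ω
    simp [hs]
  · convert hF s t (not_le.mp hs).le _ (hσ s) using 1
    ext ω
    simp [hs]

lemma measurable_valueAt {X : ℝ → Ω → ℝ≥0∞} (hF : ∀ s t, s ≤ t → F s ≤ F t)
    (hX : ∀ t ∈ Icc (0 : ℝ) T, Measurable[F t] (X t))
    (hcont : ∀ ω, ContinuousOn (fun t ↦ X t ω) (Icc 0 T))
    (hσ : ∀ t, MeasurableSet[F t] {ω | σ ω ≤ t}) (hσT : ∀ ω, σ ω ∈ Icc (0 : ℝ) T) :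
    Measurable[sigmaAt F σ] (valueAt T X σ) := by
  intro B hB
  rw [measurableSet_sigmaAt hσ]
  intro t
  by_cases ht : t < 0
  · convert @MeasurableSet.empty _ (F t)
    ext ω
    simp only [mem_inter_iff, mem_ofPred_eq, mem_empty_iff_false, iff_false, not_and, not_le]
    exact fun _ ↦ ht.trans_le (hσT ω).1
  by_cases hT : T < 0
  · convert @MeasurableSet.empty _ (F t)
    ext ω
    exact absurd ((hσT ω).1.trans (hσT ω).2) hT.not_ge
  push Not at ht hT
  set u := min t T
  have hu0 : 0 ≤ u := le_min ht hT
  have huT : u ≤ T := min_le_right _ _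
  refine hF u t (min_le_left _ _) _ ?_
  have hZ : Measurable[Real.measurableSpace.prod (F u)]
      (Function.uncurry fun (s : ℝ) (ω : Ω) ↦ X (projIcc 0 u hu0 s) ω) := by
    refine measurable_uncurry_of_continuous_of_measurable ?_ ?_
    · intro ω
      exact (hcont ω).comp_continuous (continuous_subtype_val.comp continuous_projIcc)
        fun s ↦ ⟨(projIcc 0 u hu0 s).2.1, (projIcc 0 u hu0 s).2.2.trans huT⟩
    · intro s
      have hs := (projIcc 0 u hu0 s).2
      exact (hX _ ⟨hs.1, hs.2.trans huT⟩).mono (hF _ _ hs.2) le_rfl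
  have hcomp := (hZ.comp (Measurable.prodMk (measurable_min_of_stopping hF hσ u)
    (@measurable_id _ (F u)))) hB
  convert hcomp.inter (hσ u) using 1
  ext ω
  have hiff : σ ω ≤ t ↔ σ ω ≤ u := by simp [u, (hσT ω).2]
  simp only [mem_inter_iff, mem_preimage, mem_ofPred_eq, hiff]
  refine and_congr_left fun hle ↦ ?_
  simp [valueAt, Function.uncurry, min_eq_left hle, min_eq_left (hσT ω).2,
    projIcc_of_mem hu0 ⟨(hσT ω).1, hle⟩]

lemma memFtau_inter_le {ρ τ : Ω → ℝ} (hF : ∀ s t, s ≤ t → F s ≤ F t)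
    (hρ : ∀ t, MeasurableSet[F t] {ω | ρ ω ≤ t}) (hτ : ∀ t, MeasurableSet[F t] {ω | τ ω ≤ t})
    {A : Set Ω} (hA : MemFtau F ρ A) : MemFtau F τ (A ∩ {ω | ρ ω ≤ τ ω}) := by
  intro t
  have hle := measurableSet_le (measurable_min_of_stopping hF hρ t)
    (measurable_min_of_stopping hF hτ t)
  convert ((hA t).inter hle).inter (hτ t) using 1
  ext ω
  simp only [mem_inter_iff, mem_ofPred_eq]
  constructor
  · rintro ⟨⟨h1, h2⟩, h3⟩
    exact ⟨⟨⟨h1, h2.trans h3⟩, min_le_min_right _ h2⟩, h3⟩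
  · rintro ⟨⟨⟨h1, h2⟩, h3⟩, h4⟩
    rw [min_eq_left h2, min_eq_left h4] at h3
    exact ⟨⟨h1, h3⟩, h4⟩

end StoppingTimes

/-- Bayes' formula.  For stopping times `ρ ≤ τ` with values in `[0,T]`
(`Q`- and `Q̂`-a.s.) and `Y ≥ 0` measurable w.r.t. `F_τ` with
`E^Q[Y·1_{X_τ>0}] < ∞` and `E^{Q̂}[(Y/X_τ)·1_{0<X_τ<∞}] < ∞`, any versions `g` of
`E^{Q̂}[(Y/X_τ)·1_{0<X_τ<∞} ∣ F_ρ]` and `h` of `E^Q[Y·1_{X_τ>0} ∣ F_ρ]` satisfy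
`g·1_{X_ρ>0} = h·1_{0<X_ρ<∞}·(1/X_ρ)` both `Q`- and `Q̂`-a.s., and `h = 0` `Q`-a.s.
on `{X_ρ = 0}`. -/
theorem statement4 {Ω : Type*} (F : ℝ → MeasurableSpace Ω) (T : ℝ)
    (X : ℝ → Ω → ℝ≥0∞) (x₀ : ℝ≥0∞) (Q Qh : @Measure Ω (F T))
    (hsetup : Setup F T X x₀ Q) (hQh : IsProbabilityMeasure Qh)
    (hnum : NumeraireRel F T X x₀ Q Qh)
    (ρ τ : Ω → ℝ) (hρ : IsStopT F T ρ) (hτ : IsStopT F T τ)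
    (hρT : ∀ ω, ρ ω ∈ Icc (0:ℝ) T) (hτT : ∀ ω, τ ω ∈ Icc (0:ℝ) T)
    (hρτQ : ∀ᵐ ω ∂Q, ρ ω ≤ τ ω) (hρτQh : ∀ᵐ ω ∂Qh, ρ ω ≤ τ ω)
    (Y : Ω → ℝ≥0∞) (hY : Measurable[sigmaAt F τ] Y)
    (hintQ : ∫⁻ ω in {ω | 0 < valueAt T X τ ω}, Y ω ∂Q ≠ ⊤)
    (hintQh : ∫⁻ ω in {ω | 0 < valueAt T X τ ω ∧ valueAt T X τ ω < ⊤},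
      Y ω / valueAt T X τ ω ∂Qh ≠ ⊤)
    (g h : Ω → ℝ≥0∞)
    (hg : IsCondExpOf (sigmaAt F ρ) Qh
      ({ω | 0 < valueAt T X τ ω ∧ valueAt T X τ ω < ⊤}.indicator
        (fun ω => Y ω / valueAt T X τ ω)) g)
    (hh : IsCondExpOf (sigmaAt F ρ) Q
      ({ω | 0 < valueAt T X τ ω}.indicator Y) h) :
    (∀ᵐ ω ∂Q, {ω | 0 < valueAt T X ρ ω}.indicator g ω =
      {ω | 0 < valueAt T X ρ ω ∧ valueAt T X ρ ω < ⊤}.indicator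
        (fun ω => h ω / valueAt T X ρ ω) ω) ∧
    (∀ᵐ ω ∂Qh, {ω | 0 < valueAt T X ρ ω}.indicator g ω =
      {ω | 0 < valueAt T X ρ ω ∧ valueAt T X ρ ω < ⊤}.indicator
        (fun ω => h ω / valueAt T X ρ ω) ω) ∧
    (∀ᵐ ω ∂Q, valueAt T X ρ ω = 0 → h ω = 0) := by
  have hF := hsetup.mono
  have := hsetup.prob
  have hmρ : sigmaAt F ρ ≤ F T := sigmaAt_le hρ.1 fun ω ↦ (hρT ω).2
  have hmτ : sigmaAt F τ ≤ F T := sigmaAt_le hτ.1 fun ω ↦ (hτT ω).2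
  have hU := measurable_valueAt hF hsetup.adapted hsetup.contPaths hρ.1 hρT
  have hV := measurable_valueAt hF hsetup.adapted hsetup.contPaths hτ.1 hτT
  refine bayes_of_setLIntegral_eq hmρ hU hsetup.x₀_lt_top.ne hsetup.x₀_pos.ne'
    (fun A hA ↦ hnum ρ hρ A ((measurableSet_sigmaAt hρ.1).mp hA)) hg.1 hh.1 fun A hA ↦ ?_
  have hB : MeasurableSet[sigmaAt F τ] (A ∩ {ω | ρ ω ≤ τ ω}) :=
    (measurableSet_sigmaAt hτ.1).mpr
      (memFtau_inter_le hF hρ.1 hτ.1 ((measurableSet_sigmaAt hρ.1).mp hA))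
  rw [hg.2 A hA, hh.2 A hA]
  refine setLIntegral_condExp_eq hmτ hV hsetup.x₀_lt_top.ne
    (fun B hB ↦ hnum τ hτ B ((measurableSet_sigmaAt hτ.1).mp hB)) hY hB ?_ ?_
  · filter_upwards [hρτQ] with ω hω
    exact propext ⟨fun h ↦ ⟨h, hω⟩, fun h ↦ h.1⟩
  · filter_upwards [hρτQh] with ω hω
    exact propext ⟨fun h ↦ ⟨h, hω⟩, fun h ↦ h.1⟩

end Paper
end
end
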